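/- Let M > 0, let φ ∈ 𝒬_M(R) and let λ₀ ∈ 𝔞*(P,R) ∩ E. Then for every μ ∈ ā*(P,0) one has |φ(λ₀ + μ)| ≤ (2π)^{-d} e^{M|Re μ|} ∫_E e^{-⟨λ₀,x⟩} |f_{λ₀}(x)| dx. -/

import Mathlib

noncomputable section

open Complex Real

/-- ℂ^d with the Euclidean norm. -/
abbrev Cd (d : ℕ) := EuclideanSpace ℂ (Fin d)
/-- ℝ^d with the Euclidean norm. -/
abbrev Ed (d : ℕ) := EuclideanSpace ℝ (Fin d)

/-- Componentwise real part. -/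
def rePart (d : ℕ) (l : Cd d) : Ed d := WithLp.toLp 2 fun j => (l j).re

/-- Inclusion of ℝ^d into ℂ^d. -/
def toC (d : ℕ) (x : Ed d) : Cd d := WithLp.toLp 2 fun j => (x j : ℂ)

/-- The tube 𝔞*(P,R). -/
def aStar (d : ℕ) (Sp : Finset (Ed d)) (R : ℝ) : Set (Cd d) :=
  {l | ∀ α ∈ Sp, (∑ j, (l j).re * α j) < R}

/-- The seminorm ν_{ω,n}. -/
def nu (d : ℕ) (ω : Set (Ed d)) (n : ℕ) (φ : Cd d → ℂ) : ℝ :=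
  sSup {r : ℝ | ∃ l : Cd d, rePart d l ∈ ω ∧ r = (1 + ‖l‖) ^ n * ‖φ l‖}

/-- Membership in 𝒬(R). -/
def memQ (d : ℕ) (Sp : Finset (Ed d)) (R : ℝ) (φ : Cd d → ℂ) : Prop :=
  DifferentiableOn ℂ φ (aStar d Sp R) ∧
  ∀ (n : ℕ) (ω : Set (Ed d)), Bornology.IsBounded ω → toC d '' ω ⊆ aStar d Sp R →
    ∃ C : ℝ, ∀ l : Cd d, rePart d l ∈ ω → (1 + ‖l‖) ^ n * ‖φ l‖ ≤ C

/-- Strictly antidominant. -/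
def Antidom (d : ℕ) (Sp : Finset (Ed d)) (η : Ed d) : Prop :=
  ∀ α ∈ Sp, (∑ j, η j * α j) < 0

/-- Membership in 𝒬_M(R). -/
def memQM (d : ℕ) (Sp : Finset (Ed d)) (R M : ℝ) (φ : Cd d → ℂ) : Prop :=
  memQ d Sp R φ ∧
  ∀ η : Ed d, Antidom d Sp η →
    ∃ tη Cη : ℝ, 0 < tη ∧ 0 < Cη ∧
      ∀ t : ℝ, tη ≤ t → ∀ l : Cd d, rePart d l = t • η →
        ‖φ l‖ ≤
          Cη * (1 + ‖l‖) ^ (-(d : ℝ) - 1) * Real.exp (M * ‖rePart d l‖)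

/-- The point λ₀ + iξ of ℂ^d, for λ₀, ξ ∈ ℝ^d. -/
def shift (d : ℕ) (lam0 ξ : Ed d) : Cd d := WithLp.toLp 2 fun j => (lam0 j : ℂ) + Complex.I * (ξ j : ℂ)

/-- The function f_{λ₀}(x) = ∫_E e^{⟨λ₀+iξ,x⟩} φ(λ₀+iξ) dξ. -/
def fLam (d : ℕ) (φ : Cd d → ℂ) (lam0 : Ed d) (x : Ed d) : ℂ :=
  ∫ ξ : Ed d, Complex.exp (∑ j, shift d lam0 ξ j * (x j : ℂ)) * φ (shift d lam0 ξ)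

open MeasureTheory Filter Topology Metric

lemma sum_eq_inner (d : ℕ) (x y : Ed d) : ∑ j, x j * y j = inner ℝ x y := by
  simp [PiLp.inner_apply, mul_comm]

lemma toC_mem (d : ℕ) (Sp : Finset (Ed d)) (R : ℝ) (l : Ed d) :
    toC d l ∈ aStar d Sp R ↔ ∀ α ∈ Sp, inner ℝ l α < R := by
  simp only [← sum_eq_inner]
  simp [toC, aStar]

lemma mem_iff_rePart (d : ℕ) (Sp : Finset (Ed d)) (R : ℝ) (l : Cd d) :
    l ∈ aStar d Sp R ↔ ∀ α ∈ Sp, inner ℝ (rePart d l) α < R := by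
  simp only [← sum_eq_inner]
  simp [rePart, aStar]

lemma rePart_shift (d : ℕ) (l ξ : Ed d) : rePart d (shift d l ξ) = l := by
  ext j; simp [rePart, shift]

lemma shift_mem (d : ℕ) (Sp : Finset (Ed d)) (R : ℝ) (l ξ : Ed d) :
    shift d l ξ ∈ aStar d Sp R ↔ toC d l ∈ aStar d Sp R := by
  rw [mem_iff_rePart, rePart_shift, toC_mem]

lemma norm_le_shift (d : ℕ) (l ξ : Ed d) : ‖ξ‖ ≤ ‖shift d l ξ‖ := by
  rw [EuclideanSpace.norm_eq, EuclideanSpace.norm_eq]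
  apply Real.sqrt_le_sqrt
  apply Finset.sum_le_sum
  intro i _
  gcongr
  have := Complex.abs_im_le_norm (shift d l ξ i)
  simpa [shift] using this

lemma shift_add_smul (d : ℕ) (l ξ v : Ed d) (z : ℂ) :
    shift d l ξ + z • toC d v = shift d (l + z.re • v) (ξ + z.im • v) := by
  ext j
  apply Complex.ext <;> simp [shift, toC]

lemma continuous_shift (d : ℕ) (l : Ed d) : Continuous (shift d l) := by
  unfold shift
  fun_prop

lemma isOpen_aStar (d : ℕ) (Sp : Finset (Ed d)) (R : ℝ) : IsOpen (aStar d Sp R) := by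
  have : aStar d Sp R = ⋂ α ∈ Sp, {l : Cd d | (∑ j, (l j).re * α j) < R} := by
    ext l; simp [aStar]
  rw [this]
  refine isOpen_biInter_finset fun α _ => isOpen_lt ?_ continuous_const
  refine continuous_finsetSum _ fun j _ => ?_
  have : Continuous fun l : Cd d => l j := by fun_prop
  exact (Complex.continuous_re.comp this).mul continuous_const

lemma continuous_toC (d : ℕ) : Continuous (toC d) := by
  unfold toC; fun_prop

lemma continuous_rePart (d : ℕ) : Continuous (rePart d) := by
  unfold rePart
  refine (PiLp.continuous_toLp 2 _).comp (continuous_pi fun j => ?_)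
  have : Continuous fun l : Cd d => l j := by fun_prop
  exact Complex.continuous_re.comp this

lemma decay (d : ℕ) (Sp : Finset (Ed d)) (R : ℝ) (φ : Cd d → ℂ) (hφ : memQ d Sp R φ)
    (l : Ed d) (hl : toC d l ∈ aStar d Sp R) :
    ∃ δ > 0, ∃ C > 0, ∀ l' : Ed d, ‖l' - l‖ ≤ δ → toC d l' ∈ aStar d Sp R ∧
      ∀ ξ, ‖φ (shift d l' ξ)‖ ≤ C * (1 + ‖ξ‖) ^ (-((d : ℝ) + 1)) := by
  have ho := (isOpen_aStar d Sp R).preimage (continuous_toC d)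
  obtain ⟨δ, hδ, hb⟩ := Metric.nhds_basis_closedBall.mem_iff.1 (ho.mem_nhds hl)
  obtain ⟨C, hC⟩ := hφ.2 (d+1) (closedBall l δ) isBounded_closedBall
    (by rintro _ ⟨x, hx, rfl⟩; exact hb hx)
  refine ⟨δ, hδ, max C 1, by positivity, fun l' hl' => ?_⟩
  have hm : l' ∈ closedBall l δ := by simpa [dist_eq_norm] using hl'
  refine ⟨hb hm, fun ξ => ?_⟩
  have h1 := hC (shift d l' ξ) (by rwa [rePart_shift])
  have h2 := norm_le_shift d l' ξ
  have hp : 0 < (1 + ‖ξ‖) := by positivity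
  rw [Real.rpow_neg hp.le, ← div_eq_mul_inv, le_div_iff₀ (by positivity)]
  have : (1 + ‖ξ‖) ^ ((d:ℝ)+1) = (1 + ‖ξ‖) ^ (d+1) := by
    rw [← Real.rpow_natCast]; push_cast; rfl
  rw [this]
  calc _ ≤ ‖φ (shift d l' ξ)‖ * (1 + ‖shift d l' ξ‖) ^ (d+1) := by gcongr
    _ ≤ C := by rw [mul_comm]; exact h1
    _ ≤ _ := le_max_left _ _

lemma integrable_bracket (d : ℕ) :
    Integrable (fun ξ : Ed d => (1 + ‖ξ‖) ^ (-((d : ℝ) + 1))) :=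
  integrable_one_add_norm (by simp)

lemma continuous_phi_shift (d : ℕ) (Sp : Finset (Ed d)) (R : ℝ) (φ : Cd d → ℂ)
    (hφ : DifferentiableOn ℂ φ (aStar d Sp R))
    (l : Ed d) (hl : toC d l ∈ aStar d Sp R) : Continuous fun ξ => φ (shift d l ξ) :=
  hφ.continuousOn.comp_continuous (continuous_shift d l) fun ξ => (shift_mem d Sp R l ξ).2 hl

/-- the integrand of fLam, as a function on `ℂ^d`. -/
def Fx (d : ℕ) (φ : Cd d → ℂ) (x : Ed d) (l : Cd d) : ℂ :=
  Complex.exp (∑ j, l j * (x j : ℂ)) * φ l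

lemma norm_Fx (d : ℕ) (φ : Cd d → ℂ) (x l ξ : Ed d) :
    ‖Fx d φ x (shift d l ξ)‖ = Real.exp (inner ℝ l x) * ‖φ (shift d l ξ)‖ := by
  rw [Fx, norm_mul, Complex.norm_exp, ← sum_eq_inner]
  simp [shift]

lemma diff_Fx (d : ℕ) (Sp : Finset (Ed d)) (R : ℝ) (φ : Cd d → ℂ)
    (hφ : DifferentiableOn ℂ φ (aStar d Sp R)) (x : Ed d) :
    DifferentiableOn ℂ (Fx d φ x) (aStar d Sp R) := by
  unfold Fx
  refine DifferentiableOn.mul (Differentiable.differentiableOn ?_) hφ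
  fun_prop

lemma bracket_shift (d : ℕ) (ξ w : Ed d) (hw : ‖w‖ ≤ 1) :
    (1 + ‖ξ + w‖) ^ (-((d : ℝ) + 1)) ≤ 2 ^ ((d:ℝ)+1) * (1 + ‖ξ‖) ^ (-((d : ℝ) + 1)) := by
  have h1 : 1 + ‖ξ‖ ≤ 2 * (1 + ‖ξ + w‖) := by
    have : ‖ξ‖ ≤ ‖ξ + w‖ + ‖w‖ := by simpa using norm_sub_le (ξ + w) w
    have := norm_nonneg (ξ + w)
    linarith
  have hp : 0 < (1 + ‖ξ‖) := by positivity
  have hp' : 0 < (1 + ‖ξ + w‖) := by positivity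
  rw [Real.rpow_neg hp.le, Real.rpow_neg hp'.le, ← div_eq_mul_inv, le_div_iff₀ (by positivity),
    inv_mul_le_iff₀ (by positivity), mul_comm, ← Real.mul_rpow (by positivity) (by positivity)]
  exact Real.rpow_le_rpow hp.le h1 (by positivity)

lemma decay_Fx (d : ℕ) (Sp : Finset (Ed d)) (R : ℝ) (φ : Cd d → ℂ) (hφ : memQ d Sp R φ)
    (x : Ed d) (l : Ed d) (hl : toC d l ∈ aStar d Sp R) :
    ∃ δ > 0, ∃ C > 0, ∀ l' : Ed d, ‖l' - l‖ ≤ δ → toC d l' ∈ aStar d Sp R ∧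
      ∀ ξ, ‖Fx d φ x (shift d l' ξ)‖ ≤ C * (1 + ‖ξ‖) ^ (-((d : ℝ) + 1)) := by
  obtain ⟨δ, hδ, C, hC, h⟩ := decay d Sp R φ hφ l hl
  refine ⟨δ, hδ, Real.exp ((‖l‖ + δ) * ‖x‖) * C, by positivity, fun l' hl' => ⟨(h l' hl').1, ?_⟩⟩
  intro ξ
  rw [norm_Fx, mul_assoc]
  have h1 : ‖l'‖ ≤ ‖l‖ + δ := by
    have := norm_add_le (l' - l) l
    rw [sub_add_cancel] at this
    linarith
  gcongr
  · exact (real_inner_le_norm _ _).trans (by gcongr)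
  · exact (h l' hl').2 ξ

lemma hasDeriv_zero (d : ℕ) (Sp : Finset (Ed d)) (R : ℝ) (φ : Cd d → ℂ) (hφ : memQ d Sp R φ)
    (x : Ed d) (l : Ed d) (hl : toC d l ∈ aStar d Sp R) (v : Ed d) :
    HasDerivAt (fun t : ℝ => ∫ ξ : Ed d, Fx d φ x (shift d (l + t • v) ξ)) 0 0 := by
  obtain ⟨δ, hδ, C, hC, h⟩ := decay_Fx d Sp R φ hφ x l hl
  set F := Fx d φ x with hF
  have hFd : DifferentiableOn ℂ F (aStar d Sp R) := diff_Fx d Sp R φ hφ.1 x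
  obtain ⟨r, hr, hr1, hr2⟩ : ∃ r > 0, 2 * r * ‖v‖ ≤ δ ∧ 2 * r * ‖v‖ ≤ 1 := by
    refine ⟨min δ 1 / (2 * (‖v‖ + 1)), by positivity, ?_, ?_⟩
    all_goals
      have : 2 * (min δ 1 / (2 * (‖v‖ + 1))) * ‖v‖ ≤ min δ 1 := by
        have : 2 * (min δ 1 / (2 * (‖v‖ + 1))) * ‖v‖ = min δ 1 * (‖v‖ / (‖v‖ + 1)) := by
          field_simp
        rw [this]
        refine mul_le_of_le_one_right (by positivity) ?_
        rw [div_le_one (by positivity)]; linarith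
    · exact this.trans (min_le_left _ _)
    · exact this.trans (min_le_right _ _)
  -- curve facts
  have hcurve : ∀ z : ℂ, ‖z‖ ≤ 2 * r → ‖(l + z.re • v) - l‖ ≤ δ ∧ ‖z.im • v‖ ≤ 1 := by
    intro z hz
    have h1 := Complex.abs_re_le_norm z
    have h2 := Complex.abs_im_le_norm z
    rw [add_sub_cancel_left, norm_smul, norm_smul, Real.norm_eq_abs, Real.norm_eq_abs]
    constructor
    · refine le_trans ?_ hr1
      gcongr; linarith
    · refine le_trans ?_ hr2
      gcongr; linarith
  have hmem : ∀ z : ℂ, ‖z‖ ≤ 2 * r → ∀ ξ, shift d l ξ + z • toC d v ∈ aStar d Sp R := by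
    intro z hz ξ
    rw [shift_add_smul, shift_mem]
    exact (h _ (hcurve z hz).1).1
  set C' := C * 2 ^ ((d:ℝ)+1) with hC'
  have hbd : ∀ z : ℂ, ‖z‖ ≤ 2 * r → ∀ ξ, ‖F (shift d l ξ + z • toC d v)‖ ≤
      C' * (1 + ‖ξ‖) ^ (-((d : ℝ) + 1)) := by
    intro z hz ξ
    rw [shift_add_smul]
    refine ((h _ (hcurve z hz).1).2 _).trans ?_
    rw [hC', mul_assoc]
    gcongr
    exact bracket_shift d ξ _ (hcurve z hz).2
  have hda : ∀ z : ℂ, ‖z‖ ≤ 2 * r → ∀ ξ,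
      HasDerivAt (fun z : ℂ => F (shift d l ξ + z • toC d v))
        (fderiv ℂ F (shift d l ξ + z • toC d v) (toC d v)) z := by
    intro z hz ξ
    have h1 := (hFd.differentiableAt ((isOpen_aStar d Sp R).mem_nhds (hmem z hz ξ))).hasFDerivAt
    have h2 : HasDerivAt (fun z : ℂ => shift d l ξ + z • toC d v) (toC d v) z := by
      simpa using ((hasDerivAt_id z).smul_const (toC d v)).const_add (shift d l ξ)
    exact h1.comp_hasDerivAt z h2
  have key := hasDerivAt_integral_of_dominated_loc_of_deriv_le (μ := (volume : Measure (Ed d)))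
    (F := fun (z : ℂ) ξ => F (shift d l ξ + z • toC d v))
    (F' := fun (z : ℂ) ξ => fderiv ℂ F (shift d l ξ + z • toC d v) (toC d v))
    (x₀ := (0:ℂ)) (s := ball 0 r) (bound := fun ξ => C' * (1 + ‖ξ‖) ^ (-((d : ℝ) + 1)) / r)
    (ball_mem_nhds _ hr) ?_ ?_ ?_ ?_ ?_ ?_
  rotate_left
  · filter_upwards [ball_mem_nhds (0:ℂ) hr] with z hz
    have hz : ‖z‖ < r := by simpa using hz
    refine (hFd.continuousOn.comp_continuous (f := fun ξ => shift d l ξ + z • toC d v) ?_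
      (fun ξ => hmem z (by linarith) ξ)).aestronglyMeasurable
    exact (continuous_shift d l).add continuous_const
  · refine ((integrable_bracket d).const_mul C').mono' ?_
      (Eventually.of_forall fun ξ => hbd 0 (by simp; positivity) ξ)
    refine (hFd.continuousOn.comp_continuous (f := fun ξ => shift d l ξ + (0:ℂ) • toC d v) ?_
      (fun ξ => hmem 0 (by simp; positivity) ξ)).aestronglyMeasurable
    exact (continuous_shift d l).add continuous_const
  · refine Measurable.aestronglyMeasurable ?_
    refine (measurable_fderiv_apply_const ℂ F (toC d v)).comp ?_
    exact ((continuous_shift d l).add continuous_const).measurable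
  · refine Eventually.of_forall fun ξ z hz => ?_
    have hz : ‖z‖ < r := by simpa using hz
    rw [← (hda z (by linarith) ξ).deriv]
    have hsub : ∀ w ∈ closedBall z r, ‖w‖ ≤ 2 * r := by
      intro w hw
      have : ‖w - z‖ ≤ r := by simpa [dist_eq_norm] using hw
      have := norm_add_le (w - z) z
      rw [sub_add_cancel] at this
      linarith
    refine Complex.norm_deriv_le_of_forall_mem_sphere_norm_le hr ?_ ?_
    · refine DifferentiableOn.diffContOnCl ?_
      rw [closure_ball _ hr.ne']
      exact fun w hw => (hda w (hsub w hw) ξ).differentiableAt.differentiableWithinAt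
    · exact fun w hw => hbd w (hsub w (sphere_subset_closedBall hw)) ξ
  · exact ((integrable_bracket d).const_mul C').div_const r
  · refine Eventually.of_forall fun ξ z hz => ?_
    have hz : ‖z‖ < r := by simpa using hz
    exact hda z (by linarith) ξ
  have key := key.2
  have hG : (fun z : ℂ => ∫ ξ : Ed d, F (shift d l ξ + z • toC d v)) =
      fun z : ℂ => ∫ ξ : Ed d, F (shift d (l + z.re • v) ξ) := by
    ext z
    simp_rw [shift_add_smul]
    exact integral_add_right_eq_self (fun ξ => F (shift d (l + z.re • v) ξ)) (z.im • v)
  rw [hG] at key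
  set D := ∫ ξ : Ed d, fderiv ℂ F (shift d l ξ + (0:ℂ) • toC d v) (toC d v)
  have hI : HasDerivAt (fun t : ℝ => (t : ℂ) * I) I 0 := by
    simpa using (Complex.ofRealCLM.hasDerivAt (x := (0:ℝ))).mul_const I
  have hO : HasDerivAt (fun t : ℝ => (t : ℂ)) 1 0 := by
    simpa using (hasDerivAt_id (0:ℝ)).ofReal_comp
  have k1 := HasDerivAt.comp (0:ℝ) (h₂ := fun z : ℂ => ∫ ξ : Ed d, F (shift d (l + z.re • v) ξ))
    (h₂' := D) (by simpa using key) hI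
  have k2 := HasDerivAt.comp (0:ℝ) (h₂ := fun z : ℂ => ∫ ξ : Ed d, F (shift d (l + z.re • v) ξ))
    (h₂' := D) (by simpa using key) hO
  have k3 : D * I = 0 := by
    refine k1.unique ?_
    have : ((fun z : ℂ => ∫ ξ : Ed d, F (shift d (l + z.re • v) ξ)) ∘ fun t : ℝ => (t : ℂ) * I)
      = fun _ => ∫ ξ : Ed d, F (shift d l ξ) := by
      ext t; simp
    rw [this]
    exact hasDerivAt_const _ _
  have k4 : D = 0 := by simpa using k3
  rw [k4] at k2
  simpa [Function.comp_def] using k2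

lemma fLam_eq (d : ℕ) (Sp : Finset (Ed d)) (R : ℝ) (φ : Cd d → ℂ) (hφ : memQ d Sp R φ)
    (x : Ed d) (l l' : Ed d) (hl : toC d l ∈ aStar d Sp R) (hl' : toC d l' ∈ aStar d Sp R) :
    fLam d φ l' x = fLam d φ l x := by
  have hd : ∀ t ∈ Set.Icc (0:ℝ) 1, HasDerivAt
      (fun t : ℝ => ∫ ξ : Ed d, Fx d φ x (shift d (l + t • (l' - l)) ξ)) 0 t := by
    intro t ht
    have hm : toC d (l + t • (l' - l)) ∈ aStar d Sp R := by
      rw [toC_mem] at *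
      intro α hα
      have e : l + t • (l' - l) = (1 - t) • l + t • l' := by
        rw [smul_sub, sub_smul, one_smul]; abel
      rw [e, inner_add_left, real_inner_smul_left, real_inner_smul_left]
      have h1 := hl α hα
      have h2 := hl' α hα
      have h3 := ht.1
      have h4 := ht.2
      rcases eq_or_lt_of_le h3 with h | h
      · subst h; simpa using h1
      · nlinarith [mul_le_mul_of_nonneg_left h1.le (sub_nonneg.2 h4), mul_lt_mul_of_pos_left h2 h]
    have h0 := hasDeriv_zero d Sp R φ hφ x _ hm (l' - l)
    have h1 : HasDerivAt (fun s : ℝ => s - t) 1 t := (hasDerivAt_id t).sub_const t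
    have := HasDerivAt.scomp t (h := fun s : ℝ => s - t) (by simpa using h0) h1
    simp only [smul_zero] at this
    refine this.congr_of_eventuallyEq (Eventually.of_forall fun s => ?_)
    simp only [Function.comp]
    congr 1
    ext ξ
    congr 2
    rw [sub_smul]; abel
  have := constant_of_has_deriv_right_zero (a := (0:ℝ)) (b := 1)
    (fun t ht => (hd t ht).continuousAt.continuousWithinAt)
    (fun t ht => (hd t (Set.Ico_subset_Icc_self ht)).hasDerivWithinAt) 1 (by simp)
  simpa [Fx, fLam] using this

lemma fLam_factor (d : ℕ) (φ : Cd d → ℂ) (l x : Ed d) :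
    fLam d φ l x = Complex.exp ((inner ℝ l x : ℝ) : ℂ) *
      FourierTransformInv.fourierInv (fun ξ : Ed d => φ (shift d l ξ)) ((2 * Real.pi)⁻¹ • x) := by
  rw [Real.fourierInv_eq', fLam, ← integral_const_mul]
  congr 1
  ext ξ
  rw [smul_eq_mul, ← mul_assoc, ← Complex.exp_add]
  congr 2
  rw [real_inner_smul_right, ← sum_eq_inner, ← sum_eq_inner]
  have : (Real.pi : ℂ) ≠ 0 := by exact_mod_cast Real.pi_ne_zero
  push_cast
  have e : 2 * (Real.pi : ℂ) * ((2 * (Real.pi:ℂ))⁻¹ * ∑ j, (ξ j : ℂ) * (x j : ℂ)) * I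
      = ∑ j, (I * (ξ j : ℂ)) * (x j : ℂ) := by
    rw [← mul_assoc, mul_inv_cancel₀ (by simp [this]), one_mul, Finset.sum_mul]
    exact Finset.sum_congr rfl fun j _ => by ring
  rw [e, ← Finset.sum_add_distrib]
  exact Finset.sum_congr rfl fun j _ => by simp [shift]; ring

lemma norm_fLam_factor (d : ℕ) (φ : Cd d → ℂ) (l x : Ed d) :
    Real.exp (-inner ℝ l x) * ‖fLam d φ l x‖ =
      ‖FourierTransformInv.fourierInv (fun ξ : Ed d => φ (shift d l ξ)) ((2 * Real.pi)⁻¹ • x)‖ := by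
  rw [fLam_factor, norm_mul, Complex.norm_exp, Complex.ofReal_re, ← mul_assoc, ← Real.exp_add]
  simp

lemma norm_fLam_le (d : ℕ) (φ : Cd d → ℂ) (l x : Ed d) (K : ℝ)
    (hK : ∀ ξ, ‖φ (shift d l ξ)‖ ≤ K * (1 + ‖ξ‖) ^ (-((d : ℝ) + 1))) :
    ‖fLam d φ l x‖ ≤ Real.exp (inner ℝ l x) *
      (K * ∫ ξ : Ed d, (1 + ‖ξ‖) ^ (-((d : ℝ) + 1))) := by
  rw [← integral_const_mul, ← integral_const_mul]
  refine norm_integral_le_of_norm_le (((integrable_bracket d).const_mul K).const_mul _)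
    (Eventually.of_forall fun ξ => ?_)
  have := norm_Fx d φ x l ξ
  rw [Fx] at this
  rw [this]
  gcongr
  exact hK ξ

lemma integrable_phi (d : ℕ) (Sp : Finset (Ed d)) (R : ℝ) (φ : Cd d → ℂ) (hφ : memQ d Sp R φ)
    (l : Ed d) (hl : toC d l ∈ aStar d Sp R) : Integrable fun ξ => φ (shift d l ξ) := by
  obtain ⟨δ, hδ, C, hC, h⟩ := decay d Sp R φ hφ l hl
  exact ((integrable_bracket d).const_mul C).mono'
    (continuous_phi_shift d Sp R φ hφ.1 l hl).aestronglyMeasurable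
    (Eventually.of_forall fun ξ => (h l (by simp [hδ.le])).2 ξ)

lemma integrable_exp_neg (d : ℕ) (δ : ℝ) (hδ : 0 < δ) :
    Integrable fun x : Ed d => Real.exp (-(δ * ‖x‖)) := by
  refine ((integrable_bracket d).const_mul
    (Real.exp δ * (d+1).factorial / δ ^ (d+1))).mono' (by fun_prop)
    (Eventually.of_forall fun x => ?_)
  have hp : 0 < 1 + ‖x‖ := by positivity
  have h := Real.pow_div_factorial_le_exp (x := δ * (1 + ‖x‖)) (by positivity) (d+1)
  have e : (1 + ‖x‖) ^ ((d:ℝ)+1) = (1 + ‖x‖) ^ (d+1) := by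
    rw [← Real.rpow_natCast]; push_cast; rfl
  rw [Real.norm_eq_abs, abs_of_pos (Real.exp_pos _), Real.rpow_neg hp.le, e, ← div_eq_mul_inv,
    div_div, le_div_iff₀ (by positivity), Real.exp_neg, inv_mul_le_iff₀ (by positivity),
    ← mul_assoc, ← Real.exp_add, ← mul_pow]
  rw [div_le_iff₀ (by positivity)] at h
  convert h using 3
  ring

lemma fourierInv_decay (d : ℕ) (Sp : Finset (Ed d)) (R : ℝ) (φ : Cd d → ℂ) (hφ : memQ d Sp R φ)
    (l : Ed d) (hl : toC d l ∈ aStar d Sp R) :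
    Integrable (fun x => Real.exp (-inner ℝ l x) * ‖fLam d φ l x‖) := by
  obtain ⟨δ, hδ, C, hC, h⟩ := decay d Sp R φ hφ l hl
  refine ((integrable_exp_neg d δ hδ).const_mul
    (C * ∫ ξ : Ed d, (1 + ‖ξ‖) ^ (-((d : ℝ) + 1)))).mono' ?_ (Eventually.of_forall fun x => ?_)
  · simp_rw [norm_fLam_factor]
    refine Continuous.aestronglyMeasurable ?_
    have hc : Continuous (FourierTransformInv.fourierInv (fun ξ : Ed d => φ (shift d l ξ))) := by
      rw [Real.fourierInv_eq_fourier_comp_neg]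
      refine VectorFourier.fourierIntegral_continuous Real.continuous_fourierChar
        (L := innerₗ (Ed d)) continuous_inner ?_
      exact (integrable_phi d Sp R φ hφ l hl).comp_neg
    exact (hc.comp (continuous_const_smul _)).norm
  · have hnn : ‖l - (δ * ‖x‖⁻¹) • x - l‖ ≤ δ := by
      rw [sub_sub_cancel_left, norm_neg, norm_smul, norm_mul, norm_inv, norm_norm,
        Real.norm_of_nonneg hδ.le, mul_assoc]
      exact mul_le_of_le_one_right hδ.le (inv_mul_le_one)
    obtain ⟨hm, hb⟩ := h _ hnn
    rw [← fLam_eq d Sp R φ hφ x l _ hl hm, norm_mul, norm_norm,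
      Real.norm_of_nonneg (Real.exp_pos _).le]
    calc _ ≤ _ := mul_le_mul_of_nonneg_left (norm_fLam_le d φ _ x C hb) (Real.exp_pos _).le
      _ = _ := by
        rw [← mul_assoc, ← Real.exp_add, mul_comm]
        congr 2
        rw [inner_sub_left, real_inner_smul_left, real_inner_self_eq_norm_sq]
        rcases eq_or_ne ‖x‖ 0 with h0 | h0
        · simp [h0]
        · field_simp; ring

lemma phi_le (d : ℕ) (Sp : Finset (Ed d)) (R : ℝ) (φ : Cd d → ℂ) (hφ : memQ d Sp R φ)
    (l : Ed d) (hl : toC d l ∈ aStar d Sp R) (ξ : Ed d) :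
    ‖φ (shift d l ξ)‖ ≤ (2 * Real.pi) ^ (-(d : ℤ)) *
      ∫ x, Real.exp (-inner ℝ l x) * ‖fLam d φ l x‖ := by
  have hi := fourierInv_decay d Sp R φ hφ l hl
  set g := FourierTransformInv.fourierInv (fun ξ : Ed d => φ (shift d l ξ)) with hg
  have hpi : (2 * Real.pi)⁻¹ ≠ 0 := by positivity
  simp_rw [norm_fLam_factor] at hi ⊢
  rw [← hg] at hi ⊢
  have hgc : Continuous g := by
    rw [hg, Real.fourierInv_eq_fourier_comp_neg]
    refine VectorFourier.fourierIntegral_continuous Real.continuous_fourierChar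
      (L := innerₗ (Ed d)) continuous_inner ?_
    exact (integrable_phi d Sp R φ hφ l hl).comp_neg
  have hgn : Integrable (fun x => ‖g x‖) :=
    (integrable_comp_smul_iff volume (fun x => ‖g x‖) hpi).1 hi
  have hgi : Integrable g := (integrable_norm_iff hgc.aestronglyMeasurable).1 hgn
  have hF : Integrable (FourierTransform.fourier (fun ξ : Ed d => φ (shift d l ξ))) := by
    have := hgi.comp_neg
    refine this.congr (Eventually.of_forall fun x => ?_)
    simp [hg, Real.fourierInv_eq_fourier_neg]
  have inv := (continuous_phi_shift d Sp R φ hφ.1 l hl).fourier_fourierInv_eq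
    (integrable_phi d Sp R φ hφ l hl) hF
  rw [Measure.integral_comp_smul volume (fun x => ‖g x‖), ← congrFun inv ξ, Real.fourier_eq]
  have e : (2 * Real.pi) ^ (-(d : ℤ)) * |((2 * Real.pi)⁻¹ ^ Module.finrank ℝ (Ed d))⁻¹| = 1 := by
    rw [finrank_euclideanSpace_fin, abs_of_pos (by positivity), inv_pow, inv_inv, zpow_neg,
      zpow_natCast]
    exact inv_mul_cancel₀ (by positivity)
  rw [smul_eq_mul, ← mul_assoc, e, one_mul]
  refine (norm_integral_le_integral_norm _).trans_eq ?_
  simp only [Circle.norm_smul]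
  rfl

lemma fLam_eq_zero (d : ℕ) (Sp : Finset (Ed d)) (R M : ℝ) (φ : Cd d → ℂ)
    (hφ : memQM d Sp R M φ) (l : Ed d) (hl : toC d l ∈ aStar d Sp R) (x η : Ed d)
    (hη : Antidom d Sp η) (hx : inner ℝ η x + M * ‖η‖ < 0) : fLam d φ l x = 0 := by
  obtain ⟨t0, C, ht0, hC, h⟩ := hφ.2 η hη
  have hin : ∀ᶠ t : ℝ in atTop, toC d (t • η) ∈ aStar d Sp R := by
    simp only [toC_mem]
    rw [Filter.eventually_all_finset]
    intro α hα
    have h1 : inner ℝ η α < 0 := by rw [← sum_eq_inner]; exact hη α hα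
    simp_rw [real_inner_smul_left]
    exact (tendsto_id.atTop_mul_const_of_neg h1).eventually_lt_atBot R
  set J := ∫ ξ : Ed d, (1 + ‖ξ‖) ^ (-((d : ℝ) + 1)) with hJ
  have hle : ∀ᶠ t : ℝ in atTop, ‖fLam d φ l x‖ ≤
      Real.exp (t * (inner ℝ η x + M * ‖η‖)) * (C * J) := by
    filter_upwards [hin, eventually_ge_atTop t0] with t ht htt
    rw [← fLam_eq d Sp R φ hφ.1 x l _ hl ht]
    refine (norm_fLam_le d φ (t • η) x (C * Real.exp (M * ‖t • η‖)) ?_).trans_eq ?_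
    · intro ξ
      have := h t htt (shift d (t • η) ξ) (rePart_shift _ _ _)
      rw [rePart_shift] at this
      refine this.trans ?_
      rw [mul_right_comm]
      gcongr ?_ * ?_
      rw [show -(d:ℝ) - 1 = -((d:ℝ)+1) by ring]
      refine Real.rpow_le_rpow_of_nonpos (by positivity) ?_ (by linarith [Nat.cast_nonneg (α := ℝ) d])
      linarith [norm_le_shift d (t • η) ξ]
    · rw [real_inner_smul_left, norm_smul, Real.norm_of_nonneg (by linarith : 0 ≤ t), mul_add,
        Real.exp_add, show M * (t * ‖η‖) = t * (M * ‖η‖) by ring]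
      ring
  have hlim : Tendsto (fun t : ℝ => Real.exp (t * (inner ℝ η x + M * ‖η‖)) * (C * J)) atTop
      (𝓝 0) := by
    have := (Real.tendsto_exp_atBot.comp (tendsto_id.atTop_mul_const_of_neg hx)).mul_const (C * J)
    simpa [Function.comp_def] using this
  exact norm_le_zero_iff.1 (ge_of_tendsto hlim hle)

/-- The estimate
|φ(λ₀+μ)| ≤ (2π)^{-d} e^{M|Re μ|} ∫_E e^{-⟨λ₀,x⟩} |f_{λ₀}(x)| dx for μ ∈ ā*(P,0). -/
theorem estimate_on_shifted_cone
    (d : ℕ) (hd : 1 ≤ d) (Sp : Finset (Ed d)) (hSp : (0 : Ed d) ∉ Sp)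
    (R M : ℝ) (hM : 0 < M)
    (φ : Cd d → ℂ) (hφ : memQM d Sp R M φ)
    (lam0 : Ed d) (hlam0 : toC d lam0 ∈ aStar d Sp R)
    (μ : Cd d) (hμ : μ ∈ closure (aStar d Sp 0)) :
    ‖φ (toC d lam0 + μ)‖ ≤
      (2 * Real.pi) ^ (-(d : ℤ)) * Real.exp (M * ‖rePart d μ‖) *
        ∫ x : Ed d, Real.exp (-∑ j, lam0 j * x j) * ‖fLam d φ lam0 x‖ := by
  have hin : ∀ l ∈ closure (aStar d Sp 0), ∀ α ∈ Sp, inner ℝ (rePart d l) α ≤ 0 := by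
    intro l hl α hα
    have hc : IsClosed {l : Cd d | inner ℝ (rePart d l) α ≤ 0} :=
      isClosed_le ((continuous_rePart d).inner continuous_const) continuous_const
    exact closure_minimal (fun l hl => ((mem_iff_rePart d Sp 0 l).1 hl α hα).le) hc hl
  set ν := rePart d μ with hν
  set ξ : Ed d := WithLp.toLp 2 fun j => (μ j).im with hξ
  have hs : toC d lam0 + μ = shift d (lam0 + ν) ξ := by
    ext j
    apply Complex.ext <;> simp [toC, shift, hν, hξ, rePart]
  have hl1 : toC d (lam0 + ν) ∈ aStar d Sp R := by
    rw [toC_mem] at hlam0 ⊢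
    intro α hα
    rw [inner_add_left]
    linarith [hlam0 α hα, hin μ hμ α hα]
  rw [hs]
  refine (phi_le d Sp R φ hφ.1 _ hl1 ξ).trans ?_
  rw [mul_assoc]
  refine mul_le_mul_of_nonneg_left ?_ (by positivity)
  simp_rw [sum_eq_inner]
  rw [← integral_const_mul]
  refine integral_mono (fourierInv_decay d Sp R φ hφ.1 _ hl1)
    ((fourierInv_decay d Sp R φ hφ.1 _ hlam0).const_mul _) fun x => ?_
  simp only
  rw [fLam_eq d Sp R φ hφ.1 x lam0 _ hlam0 hl1]
  by_cases h0 : fLam d φ lam0 x = 0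
  · simp [h0]
  have hc : IsClosed {l : Cd d | 0 ≤ inner ℝ (rePart d l) x + M * ‖rePart d l‖} :=
    isClosed_le continuous_const (((continuous_rePart d).inner continuous_const).add
      (continuous_const.mul (continuous_rePart d).norm))
  have hx : 0 ≤ inner ℝ ν x + M * ‖ν‖ := by
    refine closure_minimal (fun l hl => ?_) hc hμ
    by_contra hneg
    refine h0 (fLam_eq_zero d Sp R M φ hφ lam0 hlam0 x (rePart d l) ?_ (not_le.1 hneg))
    intro α hα
    rw [sum_eq_inner]
    exact (mem_iff_rePart d Sp 0 l).1 hl α hα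
  rw [← mul_assoc, ← Real.exp_add]
  gcongr
  rw [inner_add_left]
  linarith
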